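/- arXiv:2605.21259 — 3 statements merged into one kernel-verified Lean document; each statement's English description precedes it below -/
import Mathlib

section
/- Let ≺ be a linear order on ℚ, < the usual order on ℚ, and let A ⊆ ℚ be such that (A, <) is order-isomorphic to ℚ and such that no subset A' ⊆ A with (A', <) order-isomorphic to ℚ has (A', ≺) order-isomorphic to ℕ or to ℕᵒᵈ. Then there exists B ⊆ A with (B, <) order-isomorphic to ℚ such that every nonempty subset I ⊆ B which is downward closed or upward closed in (B, ≺) is non-scattered with respect to < (i.e. contains a subset order-isomorphic to ℚ under <). -/
/-- A set of rationals is non-scattered if it contains an order-isomorphic copy of `ℚ`. -/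
def IsNonScattered (S : Set ℚ) : Prop :=
  ∃ s : Set ℚ, s ⊆ S ∧ Nonempty (s ≃o ℚ)

theorem IsNonScattered.mono {S T : Set ℚ} (h : IsNonScattered S) (hST : S ⊆ T) :
    IsNonScattered T := by
  obtain ⟨s, hs, e⟩ := h
  exact ⟨s, hs.trans hST, e⟩

theorem nonempty_orderIso_rat {S : Set ℚ} (hne : S.Nonempty)
    (hdense : ∀ x ∈ S, ∀ y ∈ S, x < y → ∃ z ∈ S, x < z ∧ z < y)
    (hmin : ∀ x ∈ S, ∃ y ∈ S, y < x) (hmax : ∀ x ∈ S, ∃ y ∈ S, x < y) :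
    Nonempty (S ≃o ℚ) := by
  have : Nonempty S := hne.to_subtype
  have : DenselyOrdered S := ⟨fun x y hxy => by
    obtain ⟨z, hz, h₁, h₂⟩ := hdense x x.2 y y.2 hxy
    exact ⟨⟨z, hz⟩, h₁, h₂⟩⟩
  have : NoMinOrder S := ⟨fun x => by
    obtain ⟨y, hy, h⟩ := hmin x x.2
    exact ⟨⟨y, hy⟩, h⟩⟩
  have : NoMaxOrder S := ⟨fun x => by
    obtain ⟨y, hy, h⟩ := hmax x x.2
    exact ⟨⟨y, hy⟩, h⟩⟩
  exact Order.iso_of_countable_dense S ℚ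

/-- The image under an order embedding of a set meeting every open interval is a copy of `ℚ`. -/
theorem nonempty_image_orderIso_rat (f : ℚ ↪o ℚ) {P : Set ℚ}
    (hP : ∀ a b, a < b → ∃ p ∈ P, a < p ∧ p < b) : Nonempty (f '' P ≃o ℚ) := by
  refine nonempty_orderIso_rat ?_ ?_ ?_ ?_
  · obtain ⟨p, hp, -⟩ := hP 0 1 one_pos
    exact ⟨f p, p, hp, rfl⟩
  · rintro _ ⟨x, hx, rfl⟩ _ ⟨y, hy, rfl⟩ hxy
    obtain ⟨p, hp, h₁, h₂⟩ := hP x y (f.lt_iff_lt.1 hxy)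
    exact ⟨f p, ⟨p, hp, rfl⟩, f.lt_iff_lt.2 h₁, f.lt_iff_lt.2 h₂⟩
  · rintro _ ⟨x, hx, rfl⟩
    obtain ⟨p, hp, -, h⟩ := hP (x - 1) x (sub_one_lt x)
    exact ⟨f p, ⟨p, hp, rfl⟩, f.lt_iff_lt.2 h⟩
  · rintro _ ⟨x, hx, rfl⟩
    obtain ⟨p, hp, h, -⟩ := hP x (x + 1) (lt_add_one x)
    exact ⟨f p, ⟨p, hp, rfl⟩, f.lt_iff_lt.2 h⟩

theorem nonempty_image_Ioo_orderIso_rat (f : ℚ ↪o ℚ) {a b : ℚ} (hab : a < b) :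
    Nonempty (f '' Set.Ioo a b ≃o ℚ) := by
  refine nonempty_orderIso_rat ((Set.nonempty_Ioo.2 hab).image f) ?_ ?_ ?_
  · rintro _ ⟨x, hx, rfl⟩ _ ⟨y, hy, rfl⟩ hxy
    obtain ⟨p, h₁, h₂⟩ := exists_between (f.lt_iff_lt.1 hxy)
    exact ⟨f p, ⟨p, ⟨hx.1.trans h₁, h₂.trans hy.2⟩, rfl⟩, f.lt_iff_lt.2 h₁, f.lt_iff_lt.2 h₂⟩
  · rintro _ ⟨x, hx, rfl⟩
    obtain ⟨p, h₁, h₂⟩ := exists_between hx.1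
    exact ⟨f p, ⟨p, ⟨h₁, h₂.trans hx.2⟩, rfl⟩, f.lt_iff_lt.2 h₂⟩
  · rintro _ ⟨x, hx, rfl⟩
    obtain ⟨p, h₁, h₂⟩ := exists_between hx.2
    exact ⟨f p, ⟨p, ⟨hx.1.trans h₁, h₂⟩, rfl⟩, f.lt_iff_lt.2 h₁⟩

theorem exists_orderEmbedding_range_eq {s : Set ℚ} (e : Nonempty (s ≃o ℚ)) :
    ∃ f : ℚ ↪o ℚ, Set.range f = s := by
  obtain ⟨e⟩ := e
  refine ⟨e.symm.toOrderEmbedding.trans (OrderEmbedding.subtype (· ∈ s)), ?_⟩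
  ext x
  constructor
  · rintro ⟨y, rfl⟩
    exact (e.symm y).2
  · intro hx
    exact ⟨e ⟨x, hx⟩, by simp⟩

/-- Removing a scattered set from a non-scattered set leaves a non-scattered set. -/
theorem IsNonScattered.diff {S T : Set ℚ} (hS : IsNonScattered S) (hT : ¬ IsNonScattered T) :
    IsNonScattered (S \ T) := by
  obtain ⟨s, hs, e⟩ := hS
  obtain ⟨f, rfl⟩ := exists_orderEmbedding_range_eq e
  by_cases h : ∀ a b : ℚ, a < b → ∃ p ∈ {p | f p ∉ T}, a < p ∧ p < b
  · refine ⟨_, ?_, nonempty_image_orderIso_rat f h⟩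
    rintro _ ⟨p, hp, rfl⟩
    exact ⟨hs ⟨p, rfl⟩, hp⟩
  · push Not at h
    obtain ⟨a, b, hab, h⟩ := h
    refine absurd ⟨_, ?_, nonempty_image_Ioo_orderIso_rat f hab⟩ hT
    rintro _ ⟨p, hp, rfl⟩
    by_contra hpT
    exact (h p hpT hp.1).not_gt hp.2

theorem isNonScattered_range_inter_Ioo (f : ℚ ↪o ℚ) {a b : ℚ} (hab : a < b) :
    IsNonScattered (Set.range f ∩ Set.Ioo (f a) (f b)) := by
  refine ⟨_, ?_, nonempty_image_Ioo_orderIso_rat f hab⟩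
  rintro _ ⟨p, hp, rfl⟩
  exact ⟨⟨p, rfl⟩, f.lt_iff_lt.2 hp.1, f.lt_iff_lt.2 hp.2⟩

theorem IsNonScattered.nonempty {S : Set ℚ} (h : IsNonScattered S) : S.Nonempty := by
  obtain ⟨s, hs, ⟨e⟩⟩ := h
  exact ⟨_, hs (e.symm 0).2⟩

/-- A copy of `ℚ` stays a copy of `ℚ` when a scattered set is removed from it. -/
theorem nonempty_diff_orderIso_rat {A T : Set ℚ} (hA : Nonempty (A ≃o ℚ))
    (hT : ¬ IsNonScattered T) : Nonempty (↥(A \ T) ≃o ℚ) := by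
  obtain ⟨f, rfl⟩ := exists_orderEmbedding_range_eq hA
  have key : ∀ a b, a < b → ∃ p ∈ {p | f p ∉ T}, a < p ∧ p < b := by
    intro a b hab
    obtain ⟨_, ⟨⟨p, rfl⟩, h⟩, hp⟩ := ((isNonScattered_range_inter_Ioo f hab).diff hT).nonempty
    exact ⟨p, hp, f.lt_iff_lt.1 h.1, f.lt_iff_lt.1 h.2⟩
  have := nonempty_image_orderIso_rat f key
  rwa [show f '' {p | f p ∉ T} = Set.range f \ T by ext; aesop] at this

/-- If every open interval contains points `r`-above any given point, then some `r`-increasing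
sequence meets every open interval. -/
theorem exists_seq_dense_of_forall_exists {r : ℚ → ℚ → Prop} [IsTrans ℚ r]
    (h : ∀ x a b : ℚ, a < b → ∃ y, (a < y ∧ y < b) ∧ r x y) :
    ∃ t : ℕ → ℚ, (∀ m n, m < n → r (t m) (t n)) ∧
      ∀ a b, a < b → ∃ p ∈ Set.range t, a < p ∧ p < b := by
  obtain ⟨e, he⟩ := exists_surjective_nat (ℚ × ℚ)
  have step : ∀ (i : ℚ × ℚ) (x : ℚ), ∃ y, r x y ∧ (i.1 < i.2 → i.1 < y ∧ y < i.2) := by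
    intro i x
    by_cases hi : i.1 < i.2
    · obtain ⟨y, hy, hr⟩ := h x i.1 i.2 hi
      exact ⟨y, hr, fun _ => hy⟩
    · obtain ⟨y, -, hr⟩ := h x 0 1 one_pos
      exact ⟨y, hr, fun hi' => absurd hi' hi⟩
  choose g hg using step
  let t : ℕ → ℚ := fun n => Nat.rec 0 (fun k x => g (e k) x) n
  refine ⟨t, fun m n hmn => Nat.rel_of_forall_rel_succ_of_lt r (fun k => (hg (e k) (t k)).1) hmn,
    fun a b hab => ?_⟩
  obtain ⟨k, hk⟩ := he (a, b)
  refine ⟨t (k + 1), ⟨k + 1, rfl⟩, ?_⟩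
  have := (hg (e k) (t k)).2
  rw [hk] at this
  simpa [t, hk] using this hab

/-- The points of `A` whose weak lower ray in `A`, with respect to `r`, is scattered. -/
def scatteredRay (r : ℚ → ℚ → Prop) (A : Set ℚ) : Set ℚ :=
  {x | x ∈ A ∧ ¬ IsNonScattered {y | y ∈ A ∧ ¬ r x y}}

theorem not_isNonScattered_scatteredRay {r : ℚ → ℚ → Prop} [IsTrans ℚ r] {A : Set ℚ}
    (hno : ∀ t : ℕ → ℚ, (∀ m n, m < n → r (t m) (t n)) → Set.range t ⊆ A →
      ¬ Nonempty (Set.range t ≃o ℚ)) :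
    ¬ IsNonScattered (scatteredRay r A) := by
  rintro ⟨s, hs, e⟩
  obtain ⟨f, rfl⟩ := exists_orderEmbedding_range_eq e
  have hf : ∀ x, f x ∈ scatteredRay r A := fun x => hs ⟨x, rfl⟩
  have : IsTrans ℚ (f ⁻¹'o r) := ⟨fun a b c => IsTrans.trans (r := r) (f a) (f b) (f c)⟩
  obtain ⟨t, ht, hd⟩ := exists_seq_dense_of_forall_exists (r := f ⁻¹'o r) (by
    intro x a b hab
    by_contra! hx
    refine (hf x).2 ⟨_, ?_, nonempty_image_Ioo_orderIso_rat f hab⟩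
    rintro _ ⟨p, hp, rfl⟩
    exact ⟨(hf p).1, hx p hp⟩)
  refine hno (f ∘ t) ht ?_ ?_
  · rintro _ ⟨n, rfl⟩
    exact (hf (t n)).1
  · rw [Set.range_comp]
    exact nonempty_image_orderIso_rat f hd

/-- The range of an `r`-increasing sequence is ordered by `r` like `ℕ`. -/
theorem nonempty_range_relIso_nat {α : Type*} {r : α → α → Prop} [IsStrictOrder α r] {t : ℕ → α}
    (ht : ∀ m n, m < n → r (t m) (t n)) :
    Nonempty ((fun x y : Set.range t => r x y) ≃r ((· < ·) : ℕ → ℕ → Prop)) := by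
  have hiff : ∀ m n, r (t m) (t n) ↔ m < n := by
    refine fun m n => ⟨fun h => ?_, ht m n⟩
    by_contra! hnm
    obtain rfl | hlt := hnm.eq_or_lt
    · exact irrefl _ h
    · exact asymm h (ht n m hlt)
  have hinj : Function.Injective t := by
    intro m n hmn
    by_contra hne
    obtain h | h := lt_or_gt_of_ne hne
    · exact irrefl _ (hmn ▸ ht m n h)
    · exact irrefl _ (hmn ▸ ht n m h)
  exact ⟨RelIso.symm ⟨Equiv.ofInjective t hinj, fun {m n} => hiff m n⟩⟩

/-- Claim 3.6.2: if `lo` (written ≺) is a second linear order on ℚ and `A ⊆ ℚ` is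
order-isomorphic to ℚ under `<` and no `A' ⊆ A` with (A', <) ≅ ℚ has (A', ≺) ≅ ℕ or
(A', ≺) ≅ ℕᵒᵈ, then there is `B ⊆ A` with (B, <) ≅ ℚ such that every nonempty
≺-downward-closed or ≺-upward-closed subset of `B` is non-scattered under `<`. -/
theorem stmt_5 (lo : LinearOrder ℚ) (A : Set ℚ) (hA : Nonempty (A ≃o ℚ))
    (hno : ∀ A' : Set ℚ, A' ⊆ A → Nonempty (A' ≃o ℚ) →
      ¬ Nonempty ((fun x y : A' => lo.lt x y) ≃r ((· < ·) : ℕ → ℕ → Prop)) ∧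
      ¬ Nonempty ((fun x y : A' => lo.lt x y) ≃r ((· < ·) : ℕᵒᵈ → ℕᵒᵈ → Prop))) :
    ∃ B : Set ℚ, B ⊆ A ∧ Nonempty (B ≃o ℚ) ∧
      ∀ I : Set ℚ, I ⊆ B → I.Nonempty →
        ((∀ x ∈ I, ∀ y ∈ B, lo.lt y x → y ∈ I) ∨
         (∀ x ∈ I, ∀ y ∈ B, lo.lt x y → y ∈ I)) →
        ∃ s : Set ℚ, s ⊆ I ∧ Nonempty (s ≃o ℚ) := by
  have htri : ∀ x y, lo.lt x y ∨ x = y ∨ lo.lt y x := @lt_trichotomy ℚ lo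
  have : IsStrictOrder ℚ lo.lt :=
    { irrefl := @lt_irrefl ℚ lo.toPreorder, trans := fun _ _ _ => @lt_trans ℚ lo.toPreorder _ _ _ }
  have : IsStrictOrder ℚ (Function.swap lo.lt) :=
    { irrefl := @lt_irrefl ℚ lo.toPreorder
      trans := fun _ _ _ h₁ h₂ => @lt_trans ℚ lo.toPreorder _ _ _ h₂ h₁ }
  have hlow : ¬ IsNonScattered (scatteredRay lo.lt A) :=
    not_isNonScattered_scatteredRay fun t ht htA e =>
      (hno _ htA e).1 (nonempty_range_relIso_nat ht)
  have hhigh : ¬ IsNonScattered (scatteredRay (Function.swap lo.lt) A) :=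
    not_isNonScattered_scatteredRay fun t ht htA e =>
      (hno _ htA e).2 ((nonempty_range_relIso_nat ht).map fun i =>
        ⟨i.toEquiv.trans OrderDual.toDual, fun {x y} => i.map_rel_iff (a := y) (b := x)⟩)
  set L := scatteredRay lo.lt A
  set H := scatteredRay (Function.swap lo.lt) A
  have hLH : ¬ IsNonScattered (L ∪ H) := fun h => hhigh ((h.diff hlow).mono (by simp))
  refine ⟨A \ (L ∪ H), Set.sdiff_subset, nonempty_diff_orderIso_rat hA hLH, ?_⟩
  rintro I hI ⟨x, hx⟩ (hclosed | hclosed)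
  · have hxA : IsNonScattered {y | y ∈ A ∧ ¬ lo.lt x y} := by
      by_contra h
      exact (hI hx).2 (Or.inl ⟨(hI hx).1, h⟩)
    refine (hxA.diff hLH).mono fun y hy => ?_
    obtain h | rfl | h := htri x y
    · exact absurd h hy.1.2
    · exact hx
    · exact hclosed x hx y ⟨hy.1.1, hy.2⟩ h
  · have hxA : IsNonScattered {y | y ∈ A ∧ ¬ lo.lt y x} := by
      by_contra h
      exact (hI hx).2 (Or.inr ⟨(hI hx).1, h⟩)
    refine (hxA.diff hLH).mono fun y hy => ?_
    obtain h | rfl | h := htri x y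
    · exact hclosed x hx y ⟨hy.1.1, hy.2⟩ h
    · exact hx
    · exact absurd h hy.1.2
end

section
/- Let α be a well-ordered type, let L be a linear order, let i : L → ^α2 be an injection, let T be a countable non-scattered linear order, and let A be a copy of T in L. Then there exists a copy A' of T in L with A' ⊆ A such that at least one of the following holds: (1) the image i '' A', with the lexicographic order on ^α2, is order-isomorphicERTO to ℕ; (2) i '' A', with the lexicographic order, is order-isomorphic to ℕᵒᵈ; (3) i is order-preserving on A' (for a, b ∈ A', a < b in L iff i(a) < i(b) lexicographically); (4) i is order-reversing on A'. -/
section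

variable {L Y : Type*} [LinearOrder L] [LinearOrder Y]

/-- A subset of a linear order is non-scattered if it contains a copy of `ℚ`. -/
def NonScattered (S : Set L) : Prop := ∃ e : ℚ ↪o L, ∀ q, e q ∈ S

namespace NonScattered

theorem mono {S V : Set L} (h : NonScattered S) (hSV : S ⊆ V) : NonScattered V := by
  obtain ⟨e, he⟩ := h
  exact ⟨e, fun q => hSV (he q)⟩

theorem nonempty {S : Set L} (h : NonScattered S) : S.Nonempty := by
  obtain ⟨e, he⟩ := h
  exact ⟨e 0, he 0⟩

theorem not_singleton (a : L) : ¬ NonScattered ({a} : Set L) := by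
  rintro ⟨e, he⟩
  have h : e 0 = e 1 := (he 0).trans (he 1).symm
  exact zero_ne_one (e.injective h)

theorem of_dense {S : Set L} (hn : S.Nontrivial)
    (hd : ∀ a ∈ S, ∀ b ∈ S, a < b → ∃ c ∈ S, a < c ∧ c < b) : NonScattered S := by
  have : Nontrivial S := hn.coe_sort
  have : DenselyOrdered S := ⟨fun a b hab => by
    obtain ⟨c, hc, h1, h2⟩ := hd a a.2 b b.2 hab
    exact ⟨⟨c, hc⟩, h1, h2⟩⟩
  obtain ⟨e⟩ := Order.embedding_from_countable_to_dense ℚ S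
  exact ⟨e.trans (OrderEmbedding.subtype _), fun q => (e q).2⟩

theorem image {M : Type*} [LinearOrder M] {S : Set M} (h : NonScattered S) (e : M ↪o L) :
    NonScattered (e '' S) := by
  obtain ⟨d, hd⟩ := h
  exact ⟨d.trans e, fun q => ⟨d q, hd q, rfl⟩⟩

theorem of_ordConnected {S : Set ℚ} (hn : S.Nontrivial) (hS : S.OrdConnected) :
    NonScattered S := by
  refine of_dense hn fun a ha b hb hab => ?_
  obtain ⟨c, h1, h2⟩ := exists_between hab
  exact ⟨c, hS.out ha hb ⟨h1.le, h2.le⟩, h1, h2⟩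

theorem Ioo_rat {a b : ℚ} (hab : a < b) : NonScattered (Set.Ioo a b) := by
  refine of_ordConnected ?_ Set.ordConnected_Ioo
  obtain ⟨c, h1, h2⟩ := exists_between hab
  obtain ⟨d, h3, h4⟩ := exists_between h1
  exact ⟨c, ⟨h1, h2⟩, d, ⟨h3, h4.trans h2⟩, h4.ne'⟩

/-- Non-scattered sets are indivisible. -/
theorem or_of_union {S V : Set L} (h : NonScattered (S ∪ V)) :
    NonScattered S ∨ NonScattered V := by
  obtain ⟨e, he⟩ := h
  by_cases hd : ∀ a b : ℚ, a < b → ∃ c, e c ∈ S ∧ a < c ∧ c < b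
  · left
    have : NonScattered (e ⁻¹' S) := by
      refine of_dense ?_ fun a _ b _ hab => hd a b hab
      obtain ⟨c, hc, -, hc1⟩ := hd 0 1 one_pos
      obtain ⟨d, hd, hd1, -⟩ := hd 1 2 one_lt_two
      exact ⟨c, hc, d, hd, (hc1.trans hd1).ne⟩
    exact (this.image e).mono (Set.image_preimage_subset _ _)
  · right
    push Not at hd
    obtain ⟨a, b, hab, hd⟩ := hd
    refine ((Ioo_rat hab).image e).mono ?_
    rintro _ ⟨c, hc, rfl⟩
    exact (he c).resolve_left fun hS => absurd hc.2 (hd c hS hc.1).not_gt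

/-- A non-scattered set is cut by one of its points into two non-scattered sets. -/
theorem exists_cut {S : Set L} (h : NonScattered S) :
    ∃ c ∈ S, NonScattered (S ∩ Set.Iio c) ∧ NonScattered (S ∩ Set.Ioi c) := by
  obtain ⟨e, he⟩ := h
  refine ⟨e 0, he 0, ((Ioo_rat neg_one_lt_zero).image e).mono ?_,
    ((Ioo_rat one_pos).image e).mono ?_⟩
  · rintro _ ⟨c, hc, rfl⟩
    exact ⟨he c, e.lt_iff_lt.2 hc.2⟩
  · rintro _ ⟨c, hc, rfl⟩
    exact ⟨he c, e.lt_iff_lt.2 hc.1⟩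

/-- If every non-scattered subset of `S` can be split into two non-scattered pieces related
by `R`, then `S` has a non-scattered subset on which `<` implies `R`. -/
theorem exists_subset_of_split {S : Set L} (hS : NonScattered S) (R : L → L → Prop)
    (hR : ∀ a b, R a b → a < b)
    (hsplit : ∀ S' ⊆ S, NonScattered S' → ∃ U ⊆ S', ∃ V ⊆ S', NonScattered U ∧
      NonScattered V ∧ ∀ u ∈ U, ∀ v ∈ V, R u v) :
    ∃ X ⊆ S, NonScattered X ∧ ∀ a ∈ X, ∀ b ∈ X, a < b → R a b := by
  let F := {S' : Set L // S' ⊆ S ∧ NonScattered S'}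
  have step : ∀ W : F, ∃ (U V : F) (p : L), U.1 ⊆ W.1 ∧ V.1 ⊆ W.1 ∧ p ∈ W.1 ∧
      (∀ u ∈ U.1, R u p) ∧ (∀ v ∈ V.1, R p v) ∧ ∀ u ∈ U.1, ∀ v ∈ V.1, R u v := by
    rintro ⟨W, hWS, hW⟩
    obtain ⟨U, hUW, V, hVW, hU, hV, hUV⟩ := hsplit W hWS hW
    obtain ⟨V₀, h0V, V₁, h1V, h0, h1, h01⟩ := hsplit V (hVW.trans hWS) hV
    obtain ⟨p, hp⟩ := h0.nonempty
    exact ⟨⟨U, hUW.trans hWS, hU⟩, ⟨V₁, h1V.trans (hVW.trans hWS), h1⟩, p, hUW,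
      h1V.trans hVW, hVW (h0V hp), fun u hu => hUV u hu p (h0V hp),
      fun v hv => h01 p hp v hv, fun u hu v hv => hUV u hu v (h1V hv)⟩
  choose l r p hl hr hp hlp hpr hlr using step
  let x : List Bool → F → L := fun s => s.rec p fun b _ ih W => bif b then ih (r W) else ih (l W)
  have x_nil : ∀ W, x [] W = p W := fun _ => rfl
  have x_false : ∀ s W, x (false :: s) W = x s (l W) := fun _ _ => rfl
  have x_true : ∀ s W, x (true :: s) W = x s (r W) := fun _ _ => rfl
  have mem : ∀ s W, x s W ∈ W.1 := by
    intro s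
    induction s with
    | nil => exact hp
    | cons b s ih =>
      intro W
      cases b
      · exact hl W (ih _)
      · exact hr W (ih _)
  have total : ∀ s t, s ≠ t → ∀ W, R (x s W) (x t W) ∨ R (x t W) (x s W) := by
    intro s
    induction s with
    | nil =>
      rintro (_ | ⟨_ | _, t⟩) hst W
      · exact absurd rfl hst
      · exact Or.inr (hlp W _ (mem _ _))
      · exact Or.inl (hpr W _ (mem _ _))
    | cons b s ih =>
      rintro (_ | ⟨c, t⟩) hst W
      · cases b
        · exact Or.inl (hlp W _ (mem _ _))
        · exact Or.inr (hpr W _ (mem _ _))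
      · cases b <;> cases c
        · exact ih t (fun h => hst (h ▸ rfl)) _
        · exact Or.inl (hlr W _ (mem _ _) _ (mem _ _))
        · exact Or.inr (hlr W _ (mem _ _) _ (mem _ _))
        · exact ih t (fun h => hst (h ▸ rfl)) _
  have app_false : ∀ s W, x (s ++ [false]) W < x s W := by
    intro s
    induction s with
    | nil => exact fun W => hR _ _ (hlp W _ (mem [] _))
    | cons b s ih => intro W; cases b <;> exact ih _
  have app_true : ∀ s W, x s W < x (s ++ [true]) W := by
    intro s
    induction s with
    | nil => exact fun W => hR _ _ (hpr W _ (mem [] _))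
    | cons b s ih => intro W; cases b <;> exact ih _
  have dense : ∀ s t W, x s W < x t W → ∃ u, x s W < x u W ∧ x u W < x t W := by
    intro s
    induction s with
    | nil =>
      rintro (_ | ⟨_ | _, t⟩) W h
      · exact absurd h (lt_irrefl _)
      · exact absurd h (hR _ _ (hlp W _ (mem t _))).not_gt
      · exact ⟨true :: (t ++ [false]), hR _ _ (hpr W _ (mem _ _)), app_false t _⟩
    | cons b s ih =>
      rintro (_ | ⟨c, t⟩) W h
      · cases b
        · exact ⟨false :: (s ++ [true]), app_true s _, hR _ _ (hlp W _ (mem _ _))⟩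
        · exact absurd h (hR _ _ (hpr W _ (mem s _))).not_gt
      · cases b <;> cases c
        · obtain ⟨u, hu⟩ := ih t _ h
          exact ⟨false :: u, hu⟩
        · exact ⟨false :: (s ++ [true]), app_true s _,
            hR _ _ (hlr W _ (mem _ _) _ (mem _ _))⟩
        · exact absurd h (hR _ _ (hlr W _ (mem t _) _ (mem s _))).not_gt
        · obtain ⟨u, hu⟩ := ih t _ h
          exact ⟨true :: u, hu⟩
  let W₀ : F := ⟨S, subset_rfl, hS⟩
  refine ⟨Set.range fun s => x s W₀, ?_, of_dense ?_ ?_, ?_⟩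
  · rintro _ ⟨s, rfl⟩
    exact mem s W₀
  · exact ⟨_, ⟨[], rfl⟩, _, ⟨[true], rfl⟩, (app_true [] W₀).ne⟩
  · rintro _ ⟨s, rfl⟩ _ ⟨t, rfl⟩ h
    obtain ⟨u, hu⟩ := dense s t W₀ h
    exact ⟨_, ⟨u, rfl⟩, hu⟩
  · rintro _ ⟨s, rfl⟩ _ ⟨t, rfl⟩ h
    have hst : s ≠ t := by
      rintro rfl
      exact lt_irrefl _ h
    exact (total s t hst W₀).resolve_right fun h' => (hR _ _ h').not_gt h

/-- If every proper initial segment of `S` in the order induced by `f` is scattered, then `S`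
has a non-scattered subset enumerated increasingly with respect to `f`. -/
theorem exists_subset_strictMono {S : Set L} (hS : NonScattered S) {f : L → Y}
    (hf : Function.Injective f) (hsmall : ∀ s ∈ S, ¬ NonScattered (S ∩ {t | f t < f s})) :
    ∃ X ⊆ S, NonScattered X ∧ ∃ x : ℕ → L, StrictMono (f ∘ x) ∧ X ⊆ Set.range x := by
  obtain ⟨e, he⟩ := hS
  have key : ∀ (a b : ℚ) (r : ℚ), a < b → ∃ q, (a < q ∧ q < b) ∧ f (e r) < f (e q) := by
    intro a b r hab
    by_contra! hle
    have h : NonScattered ((S ∩ {t | f t < f (e r)}) ∪ {e r}) := by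
      refine ((Ioo_rat hab).image e).mono ?_
      rintro _ ⟨q, hq, rfl⟩
      rcases (hle q hq).lt_or_eq with h | h
      · exact Or.inl ⟨he q, h⟩
      · exact Or.inr (hf h)
    exact h.or_of_union.elim (hsmall _ (he r)) (not_singleton _)
  let I := {p : ℚ × ℚ // p.1 < p.2}
  have : Nonempty I := ⟨⟨(0, 1), one_pos⟩⟩
  obtain ⟨g, hg⟩ := exists_surjective_nat I
  choose next hnext hlt using fun (n : ℕ) (r : ℚ) => key (g n).1.1 (g n).1.2 r (g n).2
  let y : ℕ → ℚ := fun n => n.rec (next 0 0) fun k r => next (k + 1) r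
  have hy : ∀ n, (g n).1.1 < y n ∧ y n < (g n).1.2 := by
    intro n
    cases n with
    | zero => exact hnext 0 0
    | succ k => exact hnext (k + 1) (y k)
  have hmeet : ∀ a b : ℚ, a < b → ∃ n, a < y n ∧ y n < b := by
    intro a b hab
    obtain ⟨n, hn⟩ := hg ⟨(a, b), hab⟩
    have := hy n
    rw [hn] at this
    exact ⟨n, this⟩
  refine ⟨Set.range fun n => e (y n), ?_, of_dense ?_ ?_, fun n => e (y n),
    strictMono_nat_of_lt_succ fun n => hlt (n + 1) (y n), subset_rfl⟩
  · rintro _ ⟨n, rfl⟩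
    exact he _
  · obtain ⟨m, -, hm⟩ := hmeet 0 1 one_pos
    obtain ⟨n, hn, -⟩ := hmeet 1 2 one_lt_two
    exact ⟨_, ⟨m, rfl⟩, _, ⟨n, rfl⟩, (e.lt_iff_lt.2 (hm.trans hn)).ne⟩
  · rintro _ ⟨m, rfl⟩ _ ⟨n, rfl⟩ h
    obtain ⟨k, h1, h2⟩ := hmeet _ _ (e.lt_iff_lt.1 h)
    exact ⟨_, ⟨k, rfl⟩, e.lt_iff_lt.2 h1, e.lt_iff_lt.2 h2⟩

/-- An injection from a non-scattered linear order into a linear order is canonical on a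
non-scattered subset. -/
theorem exists_canonical_subset {A : Set L} (hA : NonScattered A) {f : L → Y}
    (hf : Function.Injective f) :
    ∃ X ⊆ A, NonScattered X ∧
      ((∃ x : ℕ → L, StrictMono (f ∘ x) ∧ X ⊆ Set.range x) ∨
       (∃ x : ℕ → L, StrictAnti (f ∘ x) ∧ X ⊆ Set.range x) ∨
       StrictMonoOn f X ∨ StrictAntiOn f X) := by
  by_cases hns : ∃ S ⊆ A, NonScattered S ∧ ∀ y,
      ¬ (NonScattered (S ∩ {t | f t < y}) ∧ NonScattered (S ∩ {t | y < f t}))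
  · obtain ⟨S, hSA, hS, hy⟩ := hns
    let I := {s | s ∈ S ∧ ¬ NonScattered (S ∩ {t | f t < f s})}
    let J := {s | s ∈ S ∧ ¬ NonScattered (S ∩ {t | f s < f t})}
    have hIJ : NonScattered (I ∪ J) := hS.mono fun s hs => by
      rcases not_and_or.1 (hy (f s)) with h | h
      · exact Or.inl ⟨hs, h⟩
      · exact Or.inr ⟨hs, h⟩
    rcases hIJ.or_of_union with hI | hJ
    · obtain ⟨X, hX, hXn, x, hx⟩ := hI.exists_subset_strictMono hf fun s hs h =>
        hs.2 (h.mono (Set.inter_subset_inter_left _ fun _ ht => ht.1))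
      exact ⟨X, fun a ha => hSA (hX ha).1, hXn, Or.inl ⟨x, hx⟩⟩
    · obtain ⟨X, hX, hXn, x, hx, hXx⟩ := hJ.exists_subset_strictMono
        (f := fun a => OrderDual.toDual (f a)) hf fun s hs h =>
        hs.2 (h.mono (Set.inter_subset_inter_left _ fun _ ht => ht.1))
      exact ⟨X, fun a ha => hSA (hX ha).1, hXn, Or.inr (Or.inl ⟨x, fun _ _ h => hx h, hXx⟩)⟩
  push Not at hns
  let Split (R : L → L → Prop) (S : Set L) : Prop := ∃ U ⊆ S, ∃ V ⊆ S,
    NonScattered U ∧ NonScattered V ∧ ∀ u ∈ U, ∀ v ∈ V, R u v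
  let P (a b : L) : Prop := a < b ∧ f a < f b
  let N (a b : L) : Prop := a < b ∧ f b < f a
  have hPN : ∀ S ⊆ A, NonScattered S → Split P S ∨ Split N S := by
    intro S hSA hS
    obtain ⟨y, hlo, hhi⟩ := hns S hSA hS
    obtain ⟨c, hc, hc1, hc2⟩ := hlo.exists_cut
    have hU : NonScattered ((S ∩ {t | y < f t} ∩ Set.Iio c) ∪
        (S ∩ {t | y < f t} ∩ Set.Ioi c)) := hhi.mono fun s hs => by
      rcases lt_trichotomy s c with h | h | h
      · exact Or.inl ⟨hs, h⟩
      · exact absurd hc.2 (h ▸ hs.2 : y < f c).not_gt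
      · exact Or.inr ⟨hs, h⟩
    rcases hU.or_of_union with h | h
    · exact Or.inr ⟨_, fun _ hs => hs.1.1, _, fun _ hs => hs.1.1, h, hc2,
        fun u hu v hv => ⟨lt_trans hu.2 hv.2, lt_trans hv.1.2 hu.1.2⟩⟩
    · exact Or.inl ⟨_, fun _ hs => hs.1.1, _, fun _ hs => hs.1.1, hc1, h,
        fun u hu v hv => ⟨lt_trans hu.2 hv.2, lt_trans hu.1.2 hv.1.2⟩⟩
  by_cases hP : ∀ S ⊆ A, NonScattered S → Split P S
  · obtain ⟨X, hX, hXn, h⟩ := hA.exists_subset_of_split P (fun _ _ h => h.1) hP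
    exact ⟨X, hX, hXn, Or.inr (Or.inr (Or.inl fun a ha b hb hab => (h a ha b hb hab).2))⟩
  · push Not at hP
    obtain ⟨S, hSA, hS, hP⟩ := hP
    obtain ⟨X, hX, hXn, h⟩ := hS.exists_subset_of_split N (fun _ _ h => h.1) fun S' hS' h' =>
      (hPN S' (hS'.trans hSA) h').resolve_left fun ⟨U, hU, V, hV, h⟩ =>
        hP ⟨U, hU.trans hS', V, hV.trans hS', h⟩
    exact ⟨X, hX.trans hSA, hXn,
      Or.inr (Or.inr (Or.inr fun a ha b hb hab => (h a ha b hb hab).2))⟩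

end NonScattered

end

theorem nonempty_image_orderIso_nat {L Y : Type*} [LinearOrder Y] {X : Set L} (hX : X.Infinite)
    {f : L → Y} {x : ℕ → L} (hx : StrictMono (f ∘ x)) (hXx : X ⊆ Set.range x) :
    Nonempty ((f '' X) ≃o ℕ) := by
  classical
  have himg : (f ∘ x) '' (x ⁻¹' X) = f '' X := by
    rw [Set.image_comp, Set.image_preimage_eq_of_subset hXx]
  have : Infinite (x ⁻¹' X) := by
    refine Set.infinite_coe_iff.2 fun h => hX ?_
    rw [← Set.image_preimage_eq_of_subset hXx]
    exact h.image x
  rw [← himg]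
  exact ⟨((Nat.Subtype.orderIsoOfNat (x ⁻¹' X)).trans
    ((hx.strictMonoOn _).orderIso (f ∘ x) (x ⁻¹' X))).symm⟩


/-- Claim 1 in the proof of Theorem 3.5: given an injection `i` of a linear order `L`
into `^α2` (here `Lex (α → Bool)` with the lexicographic order, `α` well-ordered),
`T` countable and non-scattered, and `A` a copy of `T` in `L`, there is a copy
`A' ⊆ A` of `T` such that either `i '' A'` is ordered as ℕ or as ℕᵒᵈ under the
lexicographic order, or `i` is order-preserving on `A'`, or order-reversing on `A'`. -/
theorem stmt_8 {L α T : Type*} [LinearOrder L] [LinearOrder α] [WellFoundedLT α]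
    [LinearOrder T] [Countable T]
    (i : L → Lex (α → Bool)) (hi : Function.Injective i)
    (hns : ∃ s : Set T, Nonempty (s ≃o ℚ))
    (A : Set L) (hA : Nonempty (A ≃o T)) :
    ∃ A' : Set L, A' ⊆ A ∧ Nonempty (A' ≃o T) ∧
      (Nonempty ((i '' A') ≃o ℕ) ∨
       Nonempty ((i '' A') ≃o ℕᵒᵈ) ∨
       (∀ a ∈ A', ∀ b ∈ A', a < b ↔ i a < i b) ∨
       (∀ a ∈ A', ∀ b ∈ A', a < b ↔ i b < i a)) := by
  obtain ⟨φ⟩ := hA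
  obtain ⟨s, ⟨ψ⟩⟩ := hns
  let j : ℚ ↪o T := ψ.symm.toOrderEmbedding.trans (OrderEmbedding.subtype _)
  have hAn : NonScattered A :=
    ⟨(j.trans φ.symm.toOrderEmbedding).trans (OrderEmbedding.subtype _), fun q => (φ.symm (j q)).2⟩
  obtain ⟨X, hXA, ⟨e, he⟩, hX⟩ := hAn.exists_canonical_subset hi
  obtain ⟨k⟩ := Order.embedding_from_countable_to_dense T ℚ
  let d : T ↪o L := k.trans e
  have hdX : Set.range d ⊆ X := by
    rintro _ ⟨t, rfl⟩
    exact he (k t)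
  have : Infinite T := Infinite.of_injective j j.injective
  have hinf : (Set.range d).Infinite := Set.infinite_range_of_injective d.injective
  refine ⟨Set.range d, hdX.trans hXA, ⟨d.orderIso.symm⟩, ?_⟩
  rcases hX with ⟨x, hx, hXx⟩ | ⟨x, hx, hXx⟩ | h | h
  · exact Or.inl (nonempty_image_orderIso_nat hinf hx (hdX.trans hXx))
  · obtain ⟨g⟩ := nonempty_image_orderIso_nat (f := fun a => OrderDual.toDual (i a)) hinf
      (fun _ _ h => hx h) (hdX.trans hXx)
    exact Or.inr (Or.inl ⟨g.dual⟩)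
  · exact Or.inr (Or.inr (Or.inl fun a ha b hb => (h.lt_iff_lt (hdX ha) (hdX hb)).symm))
  · exact Or.inr (Or.inr (Or.inr fun a ha b hb => (h.lt_iff_gt (hdX hb) (hdX ha)).symm))
end

section
/- Let R be a random graph, let G be a simple graph with a linear order < on its vertex type, and let A be a copy of R in G such that every copy B of R in G with B ⊆ A has a <-least element. Then there exists a copy S of R in G with S ⊆ A such that S is well-ordered by < (the induced order on S is a well-order). -/
namespace SimpleGraph

variable {α β : Type*}

/-- The extension property: every finite type over `G` is realised outside its parameters. -/
def HasExtensionProperty (G : SimpleGraph α) : Prop :=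
  ∀ U V : Finset α, Disjoint U V →
    ∃ w : α, w ∉ U ∧ w ∉ V ∧ (∀ u ∈ U, G.Adj w u) ∧ (∀ v ∈ V, ¬ G.Adj w v)

/-- The extension property relativised to a set of vertices. -/
def HasExtensionPropertyOn (G : SimpleGraph α) (X : Set α) : Prop :=
  ∀ U V : Finset α, (U : Set α) ⊆ X → (V : Set α) ⊆ X → Disjoint U V →
    ∃ w ∈ X, w ∉ U ∧ w ∉ V ∧ (∀ u ∈ U, G.Adj w u) ∧ (∀ v ∈ V, ¬ G.Adj w v)

/-- A finite relation which is the graph of an isomorphism between induced subgraphs. -/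
def IsPartialIso (G : SimpleGraph α) (H : SimpleGraph β) (f : Finset (α × β)) : Prop :=
  ∀ p ∈ f, ∀ q ∈ f, (p.1 = q.1 ↔ p.2 = q.2) ∧ (G.Adj p.1 q.1 ↔ H.Adj p.2 q.2)

theorem IsPartialIso.swap {G : SimpleGraph α} {H : SimpleGraph β} {f : Finset (α × β)}
    (hf : IsPartialIso G H f) :
    IsPartialIso H G (f.map (Equiv.prodComm α β).toEmbedding) := by
  intro p hp q hq
  obtain ⟨p, hp', rfl⟩ := Finset.mem_map.1 hp
  obtain ⟨q, hq', rfl⟩ := Finset.mem_map.1 hq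
  exact ⟨(hf p hp' q hq').1.symm, (hf p hp' q hq').2.symm⟩

theorem IsPartialIso.exists_extend {G : SimpleGraph α} {H : SimpleGraph β}
    (hH : H.HasExtensionProperty) {f : Finset (α × β)} (hf : IsPartialIso G H f) (a : α) :
    ∃ g, IsPartialIso G H g ∧ f ⊆ g ∧ ∃ b, (a, b) ∈ g := by
  classical
  by_cases h : ∃ b, (a, b) ∈ f
  · exact ⟨f, hf, subset_rfl, h⟩
  have hdisj : Disjoint ((f.filter fun p => G.Adj a p.1).image Prod.snd)
      ((f.filter fun p => ¬ G.Adj a p.1).image Prod.snd) := by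
    refine Finset.disjoint_left.2 fun x hx hx' => ?_
    simp only [Finset.mem_image, Finset.mem_filter] at hx hx'
    obtain ⟨p, ⟨hp, hpa⟩, rfl⟩ := hx
    obtain ⟨q, ⟨hq, hqa⟩, hqp⟩ := hx'
    exact hqa ((hf q hq p hp).1.2 hqp ▸ hpa)
  obtain ⟨b, hbU, hbV, hU, hV⟩ := hH _ _ hdisj
  have hne₁ : ∀ p ∈ f, a ≠ p.1 := fun p hp hpa => h ⟨p.2, hpa ▸ hp⟩
  have hadj : ∀ p ∈ f, (G.Adj a p.1 ↔ H.Adj b p.2) := fun p hp =>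
    ⟨fun hp' => hU _ (Finset.mem_image_of_mem _ (Finset.mem_filter.2 ⟨hp, hp'⟩)),
      not_imp_not.1 fun hp' =>
        hV _ (Finset.mem_image_of_mem _ (Finset.mem_filter.2 ⟨hp, hp'⟩))⟩
  have hne₂ : ∀ p ∈ f, b ≠ p.2 := by
    rintro p hp rfl
    by_cases hpa : G.Adj a p.1
    · exact hbU (Finset.mem_image_of_mem _ (Finset.mem_filter.2 ⟨hp, hpa⟩))
    · exact hbV (Finset.mem_image_of_mem _ (Finset.mem_filter.2 ⟨hp, hpa⟩))
  refine ⟨insert (a, b) f, fun p hp q hq => ?_, Finset.subset_insert _ _, b,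
    Finset.mem_insert_self _ _⟩
  rcases Finset.mem_insert.1 hp with rfl | hp <;> rcases Finset.mem_insert.1 hq with rfl | hq
  · simp
  · exact ⟨iff_of_false (hne₁ q hq) (hne₂ q hq), hadj q hq⟩
  · exact ⟨iff_of_false (hne₁ p hp).symm (hne₂ p hp).symm, by
      rw [G.adj_comm, H.adj_comm]; exact hadj p hp⟩
  · exact hf p hp q hq

/-- Countable graphs with the extension property are isomorphic, by back-and-forth. -/
theorem HasExtensionProperty.nonempty_iso [Countable α] [Countable β] {G : SimpleGraph α}
    {H : SimpleGraph β} (hG : G.HasExtensionProperty) (hH : H.HasExtensionProperty) :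
    Nonempty (G ≃g H) := by
  cases nonempty_encodable α
  cases nonempty_encodable β
  let P := {f : Finset (α × β) // IsPartialIso G H f}
  let left (a : α) : Order.Cofinal P :=
    { carrier := {f | ∃ b, (a, b) ∈ f.1}
      isCofinal := fun f => by
        obtain ⟨g, hg, hfg, hga⟩ := f.2.exists_extend hH a
        exact ⟨⟨g, hg⟩, hga, hfg⟩ }
  let right (b : β) : Order.Cofinal P :=
    { carrier := {f | ∃ a, (a, b) ∈ f.1}
      isCofinal := fun f => by
        obtain ⟨g, hg, hfg, a, ha⟩ := f.2.swap.exists_extend hG b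
        refine ⟨⟨_, hg.swap⟩, ⟨a, Finset.mem_map.2 ⟨_, ha, rfl⟩⟩, fun p hp => ?_⟩
        exact Finset.mem_map.2 ⟨p.swap, hfg (Finset.mem_map.2 ⟨p, hp, rfl⟩), rfl⟩ }
  let D : α ⊕ β → Order.Cofinal P := Sum.elim left right
  let I : Order.Ideal P := Order.idealOfCofinals ⟨∅, by simp [IsPartialIso]⟩ D
  have hleft (a : α) : ∃ b, ∃ f ∈ I, (a, b) ∈ f.1 := by
    obtain ⟨f, ⟨b, hb⟩, hf⟩ := Order.cofinal_meets_idealOfCofinals _ D (Sum.inl a)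
    exact ⟨b, f, hf, hb⟩
  have hright (b : β) : ∃ a, ∃ f ∈ I, (a, b) ∈ f.1 := by
    obtain ⟨f, ⟨a, ha⟩, hf⟩ := Order.cofinal_meets_idealOfCofinals _ D (Sum.inr b)
    exact ⟨a, f, hf, ha⟩
  have hI {p q : α × β} (hp : ∃ f ∈ I, p ∈ f.1) (hq : ∃ f ∈ I, q ∈ f.1) :
      (p.1 = q.1 ↔ p.2 = q.2) ∧ (G.Adj p.1 q.1 ↔ H.Adj p.2 q.2) := by
    obtain ⟨f, hf, hp⟩ := hp
    obtain ⟨g, hg, hq⟩ := hq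
    obtain ⟨m, -, hfm, hgm⟩ := I.directed _ hf _ hg
    exact m.2 p (hfm hp) q (hgm hq)
  choose F hF using hleft
  choose K hK using hright
  exact ⟨{ toFun := F
           invFun := K
           left_inv := fun a => (hI (hK (F a)) (hF a)).1.2 rfl
           right_inv := fun b => (hI (hF (K b)) (hK b)).1.1 rfl
           map_rel_iff' := fun {a b} => (hI (hF a) (hF b)).2.symm }⟩

theorem HasExtensionProperty.of_iso {G : SimpleGraph α} {H : SimpleGraph β} (e : G ≃g H)
    (hH : H.HasExtensionProperty) : G.HasExtensionProperty := by
  intro U V hUV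
  obtain ⟨w, hwU, hwV, hU, hV⟩ := hH (U.map e.toEquiv.toEmbedding) (V.map e.toEquiv.toEmbedding)
    ((Finset.disjoint_map _).2 hUV)
  have key (x : α) : H.Adj w (e x) ↔ G.Adj (e.symm w) x := by
    rw [← e.map_adj_iff, e.apply_symm_apply]
  refine ⟨e.symm w, fun h => hwU ?_, fun h => hwV ?_, fun u hu => ?_, fun v hv => ?_⟩
  · exact Finset.mem_map.2 ⟨_, h, e.apply_symm_apply w⟩
  · exact Finset.mem_map.2 ⟨_, h, e.apply_symm_apply w⟩
  · exact (key u).1 (hU _ (Finset.mem_map.2 ⟨u, hu, rfl⟩))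
  · exact fun h => hV _ (Finset.mem_map.2 ⟨v, hv, rfl⟩) ((key v).2 h)

theorem hasExtensionPropertyOn_iff_induce {G : SimpleGraph α} {X : Set α} :
    G.HasExtensionPropertyOn X ↔ (G.induce X).HasExtensionProperty := by
  classical
  constructor
  · intro h U V hUV
    obtain ⟨w, hw, hwU, hwV, hU, hV⟩ := h (U.map (Function.Embedding.subtype _))
      (V.map (Function.Embedding.subtype _)) (by simp) (by simp)
      ((Finset.disjoint_map _).2 hUV)
    exact ⟨⟨w, hw⟩, fun hm => hwU (Finset.mem_map_of_mem _ hm),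
      fun hm => hwV (Finset.mem_map_of_mem _ hm),
      fun u hu => hU _ (Finset.mem_map_of_mem _ hu),
      fun v hv => hV _ (Finset.mem_map_of_mem _ hv)⟩
  · intro h U V hUX hVX hUV
    obtain ⟨w, hwU, hwV, hU, hV⟩ := h (U.subtype (· ∈ X)) (V.subtype (· ∈ X)) (by
      refine Finset.disjoint_left.2 fun x hx hx' => ?_
      exact Finset.disjoint_left.1 hUV (Finset.mem_subtype.1 hx) (Finset.mem_subtype.1 hx'))
    exact ⟨w, w.2, fun hm => hwU (Finset.mem_subtype.2 hm),
      fun hm => hwV (Finset.mem_subtype.2 hm),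
      fun u hu => hU ⟨u, hUX hu⟩ (Finset.mem_subtype.2 hu),
      fun v hv => hV ⟨v, hVX hv⟩ (Finset.mem_subtype.2 hv)⟩

/-- The extension property passes to one of the two parts of any partition. -/
theorem HasExtensionPropertyOn.inter_or_diff {G : SimpleGraph α} {X : Set α}
    (hX : G.HasExtensionPropertyOn X) (Z : Set α) :
    G.HasExtensionPropertyOn (X ∩ Z) ∨ G.HasExtensionPropertyOn (X \ Z) := by
  classical
  by_contra! h
  obtain ⟨h₁, h₂⟩ := h
  simp only [HasExtensionPropertyOn] at h₁ h₂
  push Not at h₁ h₂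
  obtain ⟨U₁, V₁, hU₁, hV₁, hd₁, h₁⟩ := h₁
  obtain ⟨U₂, V₂, hU₂, hV₂, hd₂, h₂⟩ := h₂
  have hUX : ((U₁ ∪ U₂ : Finset α) : Set α) ⊆ X := by
    rw [Finset.coe_union]
    exact Set.union_subset (fun x hx => (hU₁ hx).1) fun x hx => (hU₂ hx).1
  have hVX : ((V₁ ∪ V₂ : Finset α) : Set α) ⊆ X := by
    rw [Finset.coe_union]
    exact Set.union_subset (fun x hx => (hV₁ hx).1) fun x hx => (hV₂ hx).1
  have hd : Disjoint (U₁ ∪ U₂) (V₁ ∪ V₂) := by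
    simp only [Finset.disjoint_union_left, Finset.disjoint_union_right]
    exact ⟨⟨hd₁, Finset.disjoint_left.2 fun x hx hx' => (hU₂ hx).2 (hV₁ hx').2⟩,
      Finset.disjoint_left.2 fun x hx hx' => (hV₂ hx').2 (hU₁ hx).2, hd₂⟩
  obtain ⟨w, hw, hwU, hwV, hU, hV⟩ := hX _ _ hUX hVX hd
  simp only [Finset.mem_union, not_or] at hwU hwV hU hV
  by_cases hwZ : w ∈ Z
  · obtain ⟨v, hv, hwv⟩ := h₁ w ⟨hw, hwZ⟩ hwU.1 hwV.1 fun u hu => hU u (Or.inl hu)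
    exact hV v (Or.inl hv) hwv
  · obtain ⟨v, hv, hwv⟩ := h₂ w ⟨hw, hwZ⟩ hwU.2 hwV.2 fun u hu => hU u (Or.inr hu)
    exact hV v (Or.inr hv) hwv

/-- The realisations of a finite type again have the extension property. -/
theorem HasExtensionPropertyOn.realizations {G : SimpleGraph α} {X : Set α}
    (hX : G.HasExtensionPropertyOn X) {U V : Finset α} (hU : (U : Set α) ⊆ X)
    (hV : (V : Set α) ⊆ X) (hUV : Disjoint U V) :
    G.HasExtensionPropertyOn
      {w | w ∈ X ∧ w ∉ U ∧ w ∉ V ∧ (∀ u ∈ U, G.Adj w u) ∧ (∀ v ∈ V, ¬ G.Adj w v)} := by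
  classical
  intro U' V' hU' hV' hd
  have hUX : ((U ∪ U' : Finset α) : Set α) ⊆ X := by
    rw [Finset.coe_union]
    exact Set.union_subset hU fun x hx => (hU' hx).1
  have hVX : ((V ∪ V' : Finset α) : Set α) ⊆ X := by
    rw [Finset.coe_union]
    exact Set.union_subset hV fun x hx => (hV' hx).1
  have hd' : Disjoint (U ∪ U') (V ∪ V') := by
    simp only [Finset.disjoint_union_left, Finset.disjoint_union_right]
    exact ⟨⟨hUV, Finset.disjoint_left.2 fun x hx hx' => (hU' hx).2.2.1 hx'⟩,
      Finset.disjoint_left.2 fun x hx hx' => (hV' hx').2.1 hx, hd⟩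
  obtain ⟨w, hw, hwU, hwV, hU, hV⟩ := hX _ _ hUX hVX hd'
  simp only [Finset.mem_union, not_or] at hwU hwV hU hV
  exact ⟨w, ⟨hw, hwU.1, hwV.1, fun u hu => hU u (Or.inl hu), fun v hv => hV v (Or.inl hv)⟩,
    hwU.2, hwV.2, fun u hu => hU u (Or.inr hu), fun v hv => hV v (Or.inr hv)⟩

theorem HasExtensionPropertyOn.nonempty {G : SimpleGraph α} {X : Set α}
    (hX : G.HasExtensionPropertyOn X) : X.Nonempty := by
  obtain ⟨w, hw, -⟩ := hX ∅ ∅ (by simp) (by simp) (by simp)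
  exact ⟨w, hw⟩

/-- If no proper initial segment of `X` contains a set with the extension property, then finite
types over `X` are realised above any finite set of parameters. -/
theorem HasExtensionPropertyOn.exists_gt [LinearOrder α] {G : SimpleGraph α} {X : Set α}
    (hX : G.HasExtensionPropertyOn X)
    (hinit : ∀ x ∈ X, ∀ Y ⊆ X, (∀ y ∈ Y, y < x) → ¬ G.HasExtensionPropertyOn Y)
    {F : Finset α} (hF : (F : Set α) ⊆ X) (D : Finset α) :
    ∃ w ∈ X, ∀ x ∈ F, x < w ∧ (G.Adj w x ↔ x ∈ D) := by
  have hT := hX.realizations (U := F ∩ D) (V := F \ D)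
    (fun x hx => hF (Finset.mem_inter.1 hx).1) (fun x hx => hF (Finset.mem_sdiff.1 hx).1)
    (Finset.disjoint_left.2 fun x hx hx' =>
      (Finset.mem_sdiff.1 hx').2 (Finset.mem_inter.1 hx).2)
  simp only [Finset.mem_inter, Finset.mem_sdiff] at hT
  rcases F.eq_empty_or_nonempty with rfl | hne
  · obtain ⟨w, hw⟩ := hX.nonempty
    exact ⟨w, hw, by simp⟩
  rcases hT.inter_or_diff (Set.Iio (F.max' hne)) with h | h
  · exact absurd h (hinit _ (hF (F.max'_mem hne)) _ (fun x hx => hx.1.1) fun x hx => hx.2)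
  obtain ⟨w, ⟨hw, hwU, hwV, hU, hV⟩, hlt⟩ := h.nonempty
  refine ⟨w, hw, fun x hx => ⟨?_, fun h => ?_, fun h => hU x ⟨hx, h⟩⟩⟩
  · refine lt_of_le_of_ne ((F.le_max' x hx).trans (not_lt.1 hlt)) ?_
    rintro rfl
    by_cases hxD : x ∈ D
    · exact hwU ⟨hx, hxD⟩
    · exact hwV ⟨hx, hxD⟩
  · by_contra hxD
    exact hV x ⟨hx, hxD⟩ h

/-- A countable set with the extension property, none of whose proper initial segments contains
such a set, has a subset of order type `ω` with the extension property. -/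
theorem HasExtensionPropertyOn.exists_strictMono [LinearOrder α] {G : SimpleGraph α} {X : Set α}
    (hX : G.HasExtensionPropertyOn X) (hc : X.Countable)
    (hinit : ∀ x ∈ X, ∀ Y ⊆ X, (∀ y ∈ Y, y < x) → ¬ G.HasExtensionPropertyOn Y) :
    ∃ s : ℕ → α, StrictMono s ∧ Set.range s ⊆ X ∧ G.HasExtensionPropertyOn (Set.range s) := by
  classical
  have := hc.to_subtype
  obtain ⟨d, hd⟩ := exists_surjective_nat (Finset X)
  let D (n : ℕ) : Finset α := (d n.unpair.1).map (Function.Embedding.subtype _)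
  have hstep (n : ℕ) (F : Finset α) :
      ∃ w, (∀ x ∈ F, x ∈ X) → w ∈ X ∧ ∀ x ∈ F, x < w ∧ (G.Adj w x ↔ x ∈ D n) := by
    by_cases hF : ∀ x ∈ F, x ∈ X
    · obtain ⟨w, hw⟩ := hX.exists_gt hinit hF (D n)
      exact ⟨w, fun _ => hw⟩
    · exact ⟨hX.nonempty.some, fun h => absurd h hF⟩
  choose step hstep using hstep
  let F : ℕ → Finset α := Nat.rec ∅ fun k E => insert (step k E) E
  let s (n : ℕ) : α := step n (F n)
  have hFsucc (n : ℕ) : F (n + 1) = insert (s n) (F n) := rfl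
  have hFX (n : ℕ) : ∀ x ∈ F n, x ∈ X := by
    induction n with
    | zero => simp [F]
    | succ n ih =>
      rw [hFsucc, Finset.forall_mem_insert]
      exact ⟨(hstep n _ ih).1, ih⟩
  have hmem {i n : ℕ} (h : i < n) : s i ∈ F n := by
    induction n with
    | zero => omega
    | succ n ih =>
      rw [hFsucc, Finset.mem_insert]
      rcases Nat.lt_succ_iff_lt_or_eq.1 h with h | rfl
      · exact Or.inr (ih h)
      · exact Or.inl rfl
  have hs {i n : ℕ} (h : i < n) : s i < s n ∧ (G.Adj (s n) (s i) ↔ s i ∈ D n) :=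
    (hstep n _ (hFX n)).2 _ (hmem h)
  have hsX (n : ℕ) : s n ∈ X := (hstep n _ (hFX n)).1
  have hmono : StrictMono s := fun i n h => (hs h).1
  refine ⟨s, hmono, Set.range_subset_iff.2 hsX, fun U V hU hV hUV => ?_⟩
  have hbdd : ∃ N, ∀ x ∈ U ∪ V, ∃ i < N, s i = x := by
    have hUV' : ∀ x ∈ U ∪ V, ∃ i, s i = x := fun x hx =>
      (Finset.mem_union.1 hx).elim (fun h => hU h) fun h => hV h
    choose! j hj using hUV'
    exact ⟨(U ∪ V).sup j + 1, fun x hx =>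
      ⟨j x, Nat.lt_succ_of_le (Finset.le_sup hx), hj x hx⟩⟩
  obtain ⟨N, hN⟩ := hbdd
  obtain ⟨c, hcU⟩ := hd (U.subtype (· ∈ X))
  have hDn (x : α) : x ∈ D (Nat.pair c N) ↔ x ∈ U := by
    simp only [D, Nat.unpair_pair, hcU, Finset.subtype_map, Finset.mem_filter,
      and_iff_left_iff_imp]
    exact fun hx => Set.range_subset_iff.2 hsX (hU hx)
  have key {x : α} (hx : x ∈ U ∪ V) :
      x < s (Nat.pair c N) ∧ (G.Adj (s (Nat.pair c N)) x ↔ x ∈ U) := by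
    obtain ⟨i, hi, rfl⟩ := hN x hx
    rw [← hDn]
    exact hs (hi.trans_le (Nat.right_le_pair c N))
  refine ⟨_, ⟨Nat.pair c N, rfl⟩, fun h => ?_, fun h => ?_, fun u hu => ?_, fun v hv h => ?_⟩
  · exact (key (Finset.mem_union_left _ h)).1.false
  · exact (key (Finset.mem_union_right _ h)).1.false
  · exact (key (Finset.mem_union_left _ hu)).2.2 hu
  · exact Finset.disjoint_right.1 hUV hv ((key (Finset.mem_union_right _ hv)).2.1 h)

end SimpleGraph


/-- The Claim in the proof of Proposition 3.9: if `R` is a random graph (countably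
infinite with the extension property), `G` a simple graph with a linear order `<` on
its vertices, and `A` a copy of `R` in `G` such that every copy of `R` inside `A` has
a `<`-least element, then there is a copy `S ⊆ A` of `R` that is well-ordered by `<`. -/
theorem stmt_14 {V W : Type*} [Countable V] [Infinite V] (R : SimpleGraph V)
    (hext : ∀ U U' : Finset V, Disjoint U U' →
      ∃ w : V, w ∉ U ∧ w ∉ U' ∧ (∀ u ∈ U, R.Adj w u) ∧ (∀ v ∈ U', ¬ R.Adj w v))
    [LinearOrder W] (G : SimpleGraph W)
    (A : Set W) (hA : Nonempty (G.induce A ≃g R))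
    (hmin : ∀ B : Set W, B ⊆ A → Nonempty (G.induce B ≃g R) →
      ∃ m ∈ B, ∀ b ∈ B, m ≤ b) :
    ∃ S : Set W, S ⊆ A ∧ Nonempty (G.induce S ≃g R) ∧ S.IsWF := by
  have hR : R.HasExtensionProperty := hext
  have hAc : A.Countable := by
    obtain ⟨e⟩ := hA
    exact Set.countable_coe_iff.1 e.toEquiv.injective.countable
  have copy_iff (B : Set W) (hB : B ⊆ A) :
      Nonempty (G.induce B ≃g R) ↔ G.HasExtensionPropertyOn B := by
    rw [SimpleGraph.hasExtensionPropertyOn_iff_induce]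
    have := (hAc.mono hB).to_subtype
    exact ⟨fun ⟨e⟩ => hR.of_iso e, fun h => h.nonempty_iso hR⟩
  have hAext := (copy_iff A subset_rfl).1 hA
  let I : Set W := {x | ∀ Y ⊆ A, (∀ y ∈ Y, y < x) → ¬ G.HasExtensionPropertyOn Y}
  obtain ⟨C, hCA, hCI, hC⟩ : ∃ C ⊆ A, C ⊆ I ∧ G.HasExtensionPropertyOn C := by
    rcases hAext.inter_or_diff I with h | h
    · exact ⟨A ∩ I, Set.inter_subset_left, Set.inter_subset_right, h⟩
    · obtain ⟨m, hm, hmle⟩ := hmin _ Set.sdiff_subset ((copy_iff _ Set.sdiff_subset).2 h)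
      obtain ⟨Y, hYA, hYm, hY⟩ :
          ∃ Y ⊆ A, (∀ y ∈ Y, y < m) ∧ G.HasExtensionPropertyOn Y := by
        simpa [I] using hm.2
      refine ⟨Y, hYA, fun y hy => ?_, hY⟩
      by_contra hyI
      exact (hYm y hy).not_ge (hmle y ⟨hYA hy, hyI⟩)
  obtain ⟨s, hs, hsC, hsext⟩ := hC.exists_strictMono (hAc.mono hCA)
    fun x hx Y hY => hCI hx Y (hY.trans hCA)
  refine ⟨Set.range s, hsC.trans hCA, (copy_iff _ (hsC.trans hCA)).2 hsext, ?_⟩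
  rw [← Set.image_univ]
  exact ((Set.isPWO_of_wellQuasiOrderedLE Set.univ).image_of_monotone hs.monotone).isWF
end
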